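/- arXiv:1603.05699 — 3 statements merged into one kernel-verified Lean document; each statement's English description precedes it below -/
import Mathlib

section
/- Let C and D be pretriangulated categories and let F : C → D be a triangulated functor. Suppose there is a set S of objects of C such that: (A) every triangulated subcategory of C that is closed under isomorphisms and contains all objects of S contains every object of C, and every triangulated subcategory of D that is closed under isomorphisms and contains F(a) for all a ∈ S contains every object of D; and (B) for all objects a, a′ ∈ S and all integers k, the map Hom_C(a, a′[k]) → Hom_D(F(a), F(a′)[k]) sending f to F(f) composed with the canonical isomorphism F(a′[k]) ≅ F(a′)[k] is bijective. Then F is an equivalence of categories. -/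
open CategoryTheory Limits CategoryTheory.Pretriangulated

namespace CategoryTheory

section

variable {C : Type*} [Category C] {D : Type*} [Category D] (F : C ⥤ D)

/-- The functor `F` induces a bijection on morphisms from `X` to `Y`. -/
def Functor.MapBijective (X Y : C) : Prop :=
  Function.Bijective (F.map : (X ⟶ Y) → (F.obj X ⟶ F.obj Y))

namespace Functor.MapBijective

variable {F}

lemma of_iso {X X' Y Y' : C} (h : F.MapBijective X Y) (e : X ≅ X') (e' : Y ≅ Y') :
    F.MapBijective X' Y' := by
  refine (Function.Bijective.of_comp_iff _ (e.homCongr e').bijective).1 ?_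
  convert ((F.mapIso e).homCongr (F.mapIso e')).bijective.comp h using 1
  funext f
  simp [Iso.homCongr]

lemma shift [HasShift C ℤ] [HasShift D ℤ] [F.CommShift ℤ] {X Y : C}
    (h : F.MapBijective X Y) (n : ℤ) : F.MapBijective (X⟦n⟧) (Y⟦n⟧) := by
  let e (Z : C) : (F.obj Z)⟦n⟧ ≅ F.obj (Z⟦n⟧) := ((F.commShiftIso n).app Z).symm
  refine (Function.Bijective.of_comp_iff _
    ((Functor.FullyFaithful.ofFullyFaithful (shiftFunctor C n)).map_bijective X Y)).1 ?_
  convert (((e X).homCongr (e Y)).bijective.comp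
    ((Functor.FullyFaithful.ofFullyFaithful (shiftFunctor D n)).map_bijective _ _)).comp h using 1
  funext f
  simp [Iso.homCongr, e]

end Functor.MapBijective

end

namespace Pretriangulated

variable {C : Type*} [Category C] [HasZeroObject C] [Preadditive C] [HasShift C ℤ]
  [∀ n : ℤ, (CategoryTheory.shiftFunctor C n).Additive] [Pretriangulated C]

lemma Triangle.exact_rightComp (T : Triangle C) (hT : T ∈ distTriang C) (A : C) :
    Function.Exact (Preadditive.rightComp A T.mor₁) (Preadditive.rightComp A T.mor₂) := by
  intro f
  constructor
  · intro hf
    obtain ⟨g, hg⟩ := T.coyoneda_exact₂ hT f hf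
    exact ⟨g, hg.symm⟩
  · rintro ⟨g, rfl⟩
    simp [Preadditive.rightComp, comp_distTriang_mor_zero₁₂ T hT]

lemma Triangle.exact_leftComp (T : Triangle C) (hT : T ∈ distTriang C) (A : C) :
    Function.Exact (Preadditive.leftComp A T.mor₂) (Preadditive.leftComp A T.mor₁) := by
  intro f
  constructor
  · intro hf
    obtain ⟨g, hg⟩ := T.yoneda_exact₂ hT f hf
    exact ⟨g, hg.symm⟩
  · rintro ⟨g, rfl⟩
    simp [Preadditive.leftComp, comp_distTriang_mor_zero₁₂_assoc T hT]

end Pretriangulated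

namespace Functor.MapBijective

variable {C : Type*} [Category C] [HasZeroObject C] [Preadditive C] [HasShift C ℤ]
  [∀ n : ℤ, (shiftFunctor C n).Additive] [Pretriangulated C]
  {D : Type*} [Category D] [HasZeroObject D] [Preadditive D] [HasShift D ℤ]
  [∀ n : ℤ, (shiftFunctor D n).Additive] [Pretriangulated D]
  {F : C ⥤ D} [F.CommShift ℤ] [F.IsTriangulated]

lemma of_isZero_left {X : C} (hX : IsZero X) (Y : C) : F.MapBijective X Y :=
  ⟨fun _ _ _ => hX.eq_of_src _ _, fun _ => ⟨0, (F.map_isZero hX).eq_of_src _ _⟩⟩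

lemma of_isZero_right (X : C) {Y : C} (hY : IsZero Y) : F.MapBijective X Y :=
  ⟨fun _ _ _ => hY.eq_of_tgt _ _, fun _ => ⟨0, (F.map_isZero hY).eq_of_tgt _ _⟩⟩

/-- The five lemma for morphisms into a distinguished triangle. -/
lemma into_obj₂ {A : C} {T : Triangle C} (hT : T ∈ distTriang C)
    (h₀ : F.MapBijective A (T.obj₃⟦(-1 : ℤ)⟧)) (h₁ : F.MapBijective A T.obj₁)
    (h₃ : F.MapBijective A T.obj₃) (h₄ : F.MapBijective A (T.obj₁⟦(1 : ℤ)⟧)) :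
    F.MapBijective A T.obj₂ :=
  have hi := inv_rot_of_distTriang T hT
  have hr := rot_of_distTriang T hT
  AddMonoidHom.bijective_of_surjective_of_bijective_of_bijective_of_injective
    (Preadditive.rightComp A T.invRotate.mor₁) (Preadditive.rightComp A T.mor₁)
    (Preadditive.rightComp A T.mor₂) (Preadditive.rightComp A T.mor₃)
    (Preadditive.rightComp (F.obj A) (F.map T.invRotate.mor₁))
    (Preadditive.rightComp (F.obj A) (F.map T.mor₁))
    (Preadditive.rightComp (F.obj A) (F.map T.mor₂))
    (Preadditive.rightComp (F.obj A) (F.map T.mor₃))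
    F.mapAddHom F.mapAddHom F.mapAddHom F.mapAddHom F.mapAddHom
    (by ext f; exact (F.map_comp f T.invRotate.mor₁).symm)
    (by ext f; exact (F.map_comp f T.mor₁).symm)
    (by ext f; exact (F.map_comp f T.mor₂).symm)
    (by ext f; exact (F.map_comp f T.mor₃).symm)
    (T.invRotate.exact_rightComp hi A) (T.exact_rightComp hT A) (T.rotate.exact_rightComp hr A)
    ((F.mapTriangle.obj T.invRotate).exact_rightComp (F.map_distinguished _ hi) (F.obj A))
    ((F.mapTriangle.obj T).exact_rightComp (F.map_distinguished _ hT) (F.obj A))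
    ((F.mapTriangle.obj T.rotate).exact_rightComp (F.map_distinguished _ hr) (F.obj A))
    h₀.2 h₁ h₃ h₄.1

/-- The five lemma for morphisms out of a distinguished triangle. -/
lemma from_obj₂ {A : C} {T : Triangle C} (hT : T ∈ distTriang C)
    (h₀ : F.MapBijective (T.obj₃⟦(-1 : ℤ)⟧) A) (h₁ : F.MapBijective T.obj₁ A)
    (h₃ : F.MapBijective T.obj₃ A) (h₄ : F.MapBijective (T.obj₁⟦(1 : ℤ)⟧) A) :
    F.MapBijective T.obj₂ A :=
  have hi := inv_rot_of_distTriang T hT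
  have hr := rot_of_distTriang T hT
  AddMonoidHom.bijective_of_surjective_of_bijective_of_bijective_of_injective
    (Preadditive.leftComp A T.mor₃) (Preadditive.leftComp A T.mor₂)
    (Preadditive.leftComp A T.mor₁) (Preadditive.leftComp A T.invRotate.mor₁)
    (Preadditive.leftComp (F.obj A) (F.map T.mor₃))
    (Preadditive.leftComp (F.obj A) (F.map T.mor₂))
    (Preadditive.leftComp (F.obj A) (F.map T.mor₁))
    (Preadditive.leftComp (F.obj A) (F.map T.invRotate.mor₁))
    F.mapAddHom F.mapAddHom F.mapAddHom F.mapAddHom F.mapAddHom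
    (by ext f; exact (F.map_comp T.mor₃ f).symm)
    (by ext f; exact (F.map_comp T.mor₂ f).symm)
    (by ext f; exact (F.map_comp T.mor₁ f).symm)
    (by ext f; exact (F.map_comp T.invRotate.mor₁ f).symm)
    (T.rotate.exact_leftComp hr A) (T.exact_leftComp hT A) (T.invRotate.exact_leftComp hi A)
    ((F.mapTriangle.obj T.rotate).exact_leftComp (F.map_distinguished _ hr) (F.obj A))
    ((F.mapTriangle.obj T).exact_leftComp (F.map_distinguished _ hT) (F.obj A))
    ((F.mapTriangle.obj T.invRotate).exact_leftComp (F.map_distinguished _ hi) (F.obj A))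
    h₄.2 h₃ h₁ h₀.1

lemma into_shift_obj₂ {A : C} {T : Triangle C} (hT : T ∈ distTriang C)
    (h₁ : ∀ k : ℤ, F.MapBijective A (T.obj₁⟦k⟧)) (h₃ : ∀ k : ℤ, F.MapBijective A (T.obj₃⟦k⟧))
    (k : ℤ) : F.MapBijective A (T.obj₂⟦k⟧) :=
  into_obj₂ (Triangle.shift_distinguished T hT k)
    ((h₃ _).of_iso (Iso.refl _) (shiftAdd T.obj₃ k (-1))) (h₁ k) (h₃ k)
    ((h₁ _).of_iso (Iso.refl _) (shiftAdd T.obj₁ k 1))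

lemma from_shift_obj₂ {A : C} {T : Triangle C} (hT : T ∈ distTriang C)
    (h₁ : ∀ k : ℤ, F.MapBijective (T.obj₁⟦k⟧) A) (h₃ : ∀ k : ℤ, F.MapBijective (T.obj₃⟦k⟧) A)
    (k : ℤ) : F.MapBijective (T.obj₂⟦k⟧) A :=
  from_obj₂ (Triangle.shift_distinguished T hT k)
    ((h₃ _).of_iso (shiftAdd T.obj₃ k (-1)) (Iso.refl _)) (h₁ k) (h₃ k)
    ((h₁ _).of_iso (shiftAdd T.obj₁ k 1) (Iso.refl _))

end Functor.MapBijective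

end CategoryTheory

/-- If a triangulated functor `F : C ⥤ D` between pretriangulated categories admits a set
of objects `S` of `C` such that (A) `S` generates `C` as a triangulated category (expressed
via predicates: any isomorphism-closed triangulated subcategory, i.e. a predicate containing
the zero objects, stable under shifts, extensions and isomorphisms, which contains `S`,
contains all of `C`), and similarly `F(S)` generates `D`; and (B) `F` induces bijections
`Hom_C(a, a'⟦k⟧) ≃ Hom_D(F a, (F a')⟦k⟧)` for all `a, a' ∈ S` and `k : ℤ`, then `F` is an
equivalence of categories. -/
theorem abg_generation_equivalence
    {C : Type*} [Category C] [HasZeroObject C] [Preadditive C] [HasShift C ℤ]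
    [∀ n : ℤ, (shiftFunctor C n).Additive] [Pretriangulated C]
    {D : Type*} [Category D] [HasZeroObject D] [Preadditive D] [HasShift D ℤ]
    [∀ n : ℤ, (shiftFunctor D n).Additive] [Pretriangulated D]
    (F : C ⥤ D) [F.CommShift ℤ] [F.IsTriangulated]
    (S : Set C)
    (hGenC : ∀ P : C → Prop,
      (∀ X Y : C, (X ≅ Y) → P X → P Y) →
      (∀ X : C, IsZero X → P X) →
      (∀ (n : ℤ) (X : C), P X → P (X⟦n⟧)) →
      (∀ T : Triangle C, T ∈ (distTriang C) → P T.obj₁ → P T.obj₃ → P T.obj₂) →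
      (∀ a ∈ S, P a) → ∀ X : C, P X)
    (hGenD : ∀ Q : D → Prop,
      (∀ X Y : D, (X ≅ Y) → Q X → Q Y) →
      (∀ X : D, IsZero X → Q X) →
      (∀ (n : ℤ) (X : D), Q X → Q (X⟦n⟧)) →
      (∀ T : Triangle D, T ∈ (distTriang D) → Q T.obj₁ → Q T.obj₃ → Q T.obj₂) →
      (∀ a ∈ S, Q (F.obj a)) → ∀ X : D, Q X)
    (hB : ∀ a ∈ S, ∀ a' ∈ S, ∀ k : ℤ,
      Function.Bijective (fun f : a ⟶ (a'⟦k⟧) =>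
        F.map f ≫ (F.commShiftIso k).hom.app a')) :
    F.IsEquivalence := by
  have h_gen (a : C) (ha : a ∈ S) (Y : C) : ∀ k : ℤ, F.MapBijective a (Y⟦k⟧) := by
    refine hGenC (fun Y => ∀ k : ℤ, F.MapBijective a (Y⟦k⟧))
      (fun X Y e h k => (h k).of_iso (Iso.refl _) ((shiftFunctor C k).mapIso e))
      (fun X hX k => .of_isZero_right _ ((shiftFunctor C k).map_isZero hX))
      (fun n X h k => (h (n + k)).of_iso (Iso.refl _) (shiftAdd X n k))
      (fun T hT h₁ h₃ k => .into_shift_obj₂ hT h₁ h₃ k) (fun a' ha' k => ?_) Y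
    exact (Function.Bijective.of_comp_iff' (((F.commShiftIso k).app a').homToEquiv).bijective
      _).1 (hB a ha a' ha' k)
  have h_shift (X Y : C) : ∀ k : ℤ, F.MapBijective (X⟦k⟧) Y :=
    hGenC (fun X => ∀ k : ℤ, F.MapBijective (X⟦k⟧) Y)
      (fun X X' e h k => (h k).of_iso ((shiftFunctor C k).mapIso e) (Iso.refl _))
      (fun X hX k => .of_isZero_left ((shiftFunctor C k).map_isZero hX) _)
      (fun n X h k => (h (n + k)).of_iso (shiftAdd X n k) (Iso.refl _))
      (fun T hT h₁ h₃ k => .from_shift_obj₂ hT h₁ h₃ k)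
      (fun a ha k => ((h_gen a ha Y (-k)).shift k).of_iso (Iso.refl _) (shiftNegShift Y k)) X
  have h (X Y : C) : F.MapBijective X Y :=
    (h_shift X Y 0).of_iso (shiftZero ℤ X) (Iso.refl _)
  have : F.Faithful := ⟨fun {X Y} _ _ hf => (h X Y).1 hf⟩
  have : F.Full := ⟨fun {X Y} => (h X Y).2⟩
  have : F.EssSurj := ⟨hGenD F.essImage (fun _ _ e hX => F.essImage.prop_of_iso e hX)
    (fun _ hX => F.essImage.prop_of_isZero hX)
    (fun n X hX => F.essImage.le_shift n X hX)
    (fun T hT h₁ h₃ => F.essImage.ext_of_isTriangulatedClosed₂ T hT h₁ h₃)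
    (fun a _ => F.obj_mem_essImage a)⟩
  exact {}
end

section
/- With notation as in the context, assume in addition that there exists d ∈ {2, 3} such that d_β ∈ {1, d} for every β ∈ R (the classical normalization for an indecomposable root system with two root lengths). If gcd(d_β, ℓ) ≠ 1 for some β ∈ R, then W_{D,ℓ} = W_ℓ∨ as subgroups of the group of bijections of E. -/
open RealInnerProductSpace

/-- The affine reflection `s_{v,m} : λ ↦ λ − (2⟪λ,v⟫/⟪v,v⟫ − m)·v`, as a bijection of `E`. -/
noncomputable def affineReflection {E : Type*} [NormedAddCommGroup E] [InnerProductSpace ℝ E]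
    (v : E) (m : ℤ) : Equiv.Perm E :=
  Function.Involutive.toPerm (fun x => x - (2 * ⟪x, v⟫ / ⟪v, v⟫ - (m : ℝ)) • v)
    (by
      intro x
      by_cases hv : (⟪v, v⟫ : ℝ) = 0
      · have hv0 : v = 0 := inner_self_eq_zero.mp hv
        simp [hv0]
      · have hx : ⟪x - (2 * ⟪x, v⟫ / ⟪v, v⟫ - (m : ℝ)) • v, v⟫
            = ⟪x, v⟫ - (2 * ⟪x, v⟫ / ⟪v, v⟫ - (m : ℝ)) * ⟪v, v⟫ := by
          rw [inner_sub_left, real_inner_smul_left]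
        dsimp only
        rw [hx]
        have key : 2 * (⟪x, v⟫ - (2 * ⟪x, v⟫ / ⟪v, v⟫ - (m : ℝ)) * ⟪v, v⟫) / ⟪v, v⟫ - (m : ℝ)
            = -(2 * ⟪x, v⟫ / ⟪v, v⟫ - (m : ℝ)) := by
          field_simp
          ring
        rw [key, neg_smul, sub_neg_eq_add, sub_add_cancel])

/-- `W_ℓ = ⟨ s_{β,nℓ} : β ∈ R, n ∈ ℤ ⟩`, the subgroup of bijections of `E` generated by the
affine reflections in roots with parameters the multiples of `ℓ`. -/
noncomputable def Wl {E : Type*} [NormedAddCommGroup E] [InnerProductSpace ℝ E]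
    (R : Set E) (ℓ : ℕ) : Subgroup (Equiv.Perm E) :=
  Subgroup.closure {g | ∃ β ∈ R, ∃ n : ℤ, g = affineReflection β (n * (ℓ : ℤ))}

/-- `W_{D,ℓ} = ⟨ s_{β, m ℓ_β} : β ∈ R, m ∈ ℤ ⟩` where `ℓ_β = ℓ / gcd(ℓ, d_β)`. -/
noncomputable def WDl {E : Type*} [NormedAddCommGroup E] [InnerProductSpace ℝ E]
    (R : Set E) (d : E → ℕ) (ℓ : ℕ) : Subgroup (Equiv.Perm E) :=
  Subgroup.closure
    {g | ∃ β ∈ R, ∃ m : ℤ, g = affineReflection β (m * ((ℓ / Nat.gcd ℓ (d β) : ℕ) : ℤ))}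

/-- `W_ℓ∨ = ⟨ s_{β∨,nℓ} : β ∈ R, n ∈ ℤ ⟩`, where `β∨ = (2/⟪β,β⟫)·β` is the coroot. -/
noncomputable def Wlv {E : Type*} [NormedAddCommGroup E] [InnerProductSpace ℝ E]
    (R : Set E) (ℓ : ℕ) : Subgroup (Equiv.Perm E) :=
  Subgroup.closure
    {g | ∃ β ∈ R, ∃ n : ℤ, g = affineReflection ((2 / ⟪β, β⟫) • β) (n * (ℓ : ℤ))}

/-- The reflection in the coroot `β∨` with parameter `a * k` is the reflection in `β` with
parameter `a`, when `⟪β, β⟫ = 2 * k`. -/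
theorem affineReflection_coroot {E : Type*} [NormedAddCommGroup E] [InnerProductSpace ℝ E]
    (β : E) (k : ℕ) (hk : 0 < k) (hβ : ⟪β, β⟫ = 2 * (k : ℝ)) (a : ℤ) :
    affineReflection ((2 / ⟪β, β⟫) • β) (a * (k : ℤ)) = affineReflection β a := by
  have hk' : (k : ℝ) ≠ 0 := by positivity
  ext x
  simp only [affineReflection, Function.Involutive.coe_toPerm, real_inner_smul_left,
    real_inner_smul_right, hβ, smul_smul]
  congr 2
  push_cast
  field_simp

/-- With `R ⊆ E` a reduced crystallographic root system whose roots `β` have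
`d_β = ⟪β,β⟫/2` a positive integer taking values in `{1, d}` for a fixed `d ∈ {2, 3}`,
and `ℓ` a positive integer: if `gcd(d_β, ℓ) ≠ 1` for some `β ∈ R`, then
`W_{D,ℓ} = W_ℓ∨` as subgroups of the group of bijections of `E`. -/
theorem WDl_eq_Wlv {E : Type*} [NormedAddCommGroup E] [InnerProductSpace ℝ E]
    [FiniteDimensional ℝ E]
    (R : Set E) (hRfin : R.Finite) (hR0 : ∀ β ∈ R, β ≠ 0)
    (hRspan : Submodule.span ℝ R = ⊤)
    (hRrefl : ∀ α ∈ R, ∀ β ∈ R, β - (2 * ⟪β, α⟫ / ⟪α, α⟫) • α ∈ R)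
    (hRcrys : ∀ α ∈ R, ∀ β ∈ R, ∃ z : ℤ, 2 * ⟪β, α⟫ / ⟪α, α⟫ = (z : ℝ))
    (hRred : ∀ α ∈ R, ∀ t : ℝ, t • α ∈ R → t = 1 ∨ t = -1)
    (d : E → ℕ) (hd : ∀ β ∈ R, 0 < d β ∧ ⟪β, β⟫ = 2 * (d β : ℝ))
    (ℓ : ℕ) (hℓ : 0 < ℓ)
    (hlen : ∃ c : ℕ, (c = 2 ∨ c = 3) ∧ ∀ β ∈ R, d β = 1 ∨ d β = c)
    (hnotcop : ∃ β ∈ R, Nat.gcd (d β) ℓ ≠ 1) :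
    WDl R d ℓ = Wlv R ℓ := by
  obtain ⟨c, hc, hdc⟩ := hlen
  obtain ⟨γ, hγ, hγℓ⟩ := hnotcop
  have hcprime : c.Prime := by
    rcases hc with rfl | rfl
    exacts [Nat.prime_two, Nat.prime_three]
  have hcℓ : c ∣ ℓ := by
    rcases hdc γ hγ with h | h
    · simp [h] at hγℓ
    · rw [h] at hγℓ
      exact (hcprime.dvd_iff_not_coprime).mpr hγℓ
  have hdvd : ∀ β ∈ R, d β ∣ ℓ := by
    intro β hβ
    rcases hdc β hβ with h | h <;> simp [h, hcℓ]
  have hgen : ∀ β ∈ R, ∀ n : ℤ, affineReflection ((2 / ⟪β, β⟫) • β) (n * (ℓ : ℤ)) =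
      affineReflection β (n * ((ℓ / Nat.gcd ℓ (d β) : ℕ) : ℤ)) := by
    intro β hβ n
    rw [← affineReflection_coroot β (d β) (hd β hβ).1 (hd β hβ).2,
      Nat.gcd_eq_right (hdvd β hβ), mul_assoc, ← Nat.cast_mul, Nat.div_mul_cancel (hdvd β hβ)]
  unfold WDl Wlv
  congr 1
  ext g
  constructor
  · rintro ⟨β, hβ, n, rfl⟩
    exact ⟨β, hβ, n, (hgen β hβ n).symm⟩
  · rintro ⟨β, hβ, n, rfl⟩
    exact ⟨β, hβ, n, hgen β hβ n⟩
end

section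
/- Let M be a bounded complex of A-modules such that each term M_i is locally finite and each cohomology module H^i(M) is finite-dimensional over k. Then M admits a subcomplex F = (F_i) such that every F_i is finite-dimensional over k and the inclusion F ⊆ M is a quasi-isomorphism. -/
/-- Given a complex `(M i, δ i)` of `A`-modules (the differential `δ i : M i → M (i+1)`)
and a family of submodules `F i ⊆ M i`, this is the natural map
`(F (i+1) ∩ ker δ_{i+1}) / δ_i(F i) → ker δ_{i+1} / range δ_i` induced by the inclusion;
the target is the cohomology of `M` at position `i + 1`. -/
noncomputable def inducedCohMap {A : Type*} [Ring A]
    {M : ℤ → Type*} [∀ i, AddCommGroup (M i)] [∀ i, Module A (M i)]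
    (δ : ∀ i : ℤ, M i →ₗ[A] M (i + 1))
    (F : ∀ i : ℤ, Submodule A (M i)) (i : ℤ) :
    (↥(F (i + 1) ⊓ LinearMap.ker (δ (i + 1))) ⧸
        Submodule.comap (F (i + 1) ⊓ LinearMap.ker (δ (i + 1))).subtype
          (Submodule.map (δ i) (F i))) →ₗ[A]
      (↥(LinearMap.ker (δ (i + 1))) ⧸
        Submodule.comap (LinearMap.ker (δ (i + 1))).subtype (LinearMap.range (δ i))) :=
  Submodule.liftQ _
    ((Submodule.mkQ _).comp (Submodule.inclusion inf_le_right))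
    (by
      intro x hx
      obtain ⟨w, -, hwx⟩ := Submodule.mem_map.mp (Submodule.mem_comap.mp hx)
      rw [LinearMap.mem_ker, LinearMap.comp_apply, Submodule.mkQ_apply,
        Submodule.Quotient.mk_eq_zero, Submodule.mem_comap]
      exact ⟨w, hwx⟩)

/-- A finitely generated submodule of the range of a linear map is the image of a finitely
generated submodule. -/
theorem Submodule.FG.exists_fg_map_eq {R M N : Type*} [Ring R] [AddCommGroup M] [AddCommGroup N]
    [Module R M] [Module R N] (f : M →ₗ[R] N) {p : Submodule R N} (hp : p.FG)
    (hle : p ≤ LinearMap.range f) : ∃ q : Submodule R M, q.FG ∧ q.map f = p := by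
  classical
  obtain ⟨s, rfl⟩ := hp
  have hs : (s : Set N) ⊆ f '' Set.univ := by
    rw [Set.image_univ, ← LinearMap.coe_range]
    exact Submodule.span_le.mp hle
  obtain ⟨t, -, rfl⟩ := Finset.subset_set_image_iff.mp hs
  exact ⟨Submodule.span R t, ⟨t, rfl⟩, by rw [Submodule.map_span, Finset.coe_image]⟩

/-- If `K / (K ∩ B)` is finitely generated, then `K` is covered by `B` together with a finitely
generated submodule of `K`. -/
theorem Submodule.exists_fg_le_sup {R M : Type*} [Ring R] [AddCommGroup M] [Module R M]
    (K B : Submodule R M) [Module.Finite R (K ⧸ B.comap K.subtype)] :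
    ∃ P : Submodule R M, P.FG ∧ P ≤ K ∧ K ≤ P ⊔ B := by
  obtain ⟨q, hq, hmap⟩ := Submodule.FG.exists_fg_map_eq (B.comap K.subtype).mkQ
    (Module.Finite.fg_top (R := R) (M := K ⧸ B.comap K.subtype)) (by simp)
  refine ⟨q.map K.subtype, hq.map _, Submodule.map_subtype_le K q, fun x hx => ?_⟩
  obtain ⟨y, hy, hxy⟩ : (B.comap K.subtype).mkQ ⟨x, hx⟩ ∈ q.map (B.comap K.subtype).mkQ := by
    simp [hmap]
  have hB : x - y ∈ B := by
    simpa using (Submodule.Quotient.eq _).mp hxy.symm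
  exact Submodule.mem_sup.mpr
    ⟨y, Submodule.mem_map_of_mem (f := K.subtype) hy, x - y, hB, by abel⟩

/-- Let `K` be the kernel of `g` and let `G` be a finite-dimensional submodule of the codomain. If
the domain is locally finite and `K / (K ∩ B)` is finite-dimensional, then some finite-dimensional
submodule has image `G ∩ range g` and covers `K` modulo `B`. -/
theorem exists_finiteDimensional_map_eq_inf_range {k A M N : Type*} [Field k] [Ring A] [Algebra k A]
    [AddCommGroup M] [Module k M] [Module A M] [IsScalarTower k A M]
    [AddCommGroup N] [Module k N] [Module A N] [IsScalarTower k A N]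
    (hM : ∀ p : Submodule A M, p.FG → FiniteDimensional k p)
    (g : M →ₗ[A] N) (B : Submodule A M)
    (hfin : FiniteDimensional k (LinearMap.ker g ⧸ B.comap (LinearMap.ker g).subtype))
    (G : Submodule A N) (hG : FiniteDimensional k G) :
    ∃ F : Submodule A M, FiniteDimensional k F ∧ F.map g = G ⊓ LinearMap.range g ∧
      LinearMap.ker g ≤ F ⊔ B := by
  have : Module.Finite A (LinearMap.ker g ⧸ B.comap (LinearMap.ker g).subtype) :=
    Module.Finite.of_restrictScalars_finite k A _
  obtain ⟨P, hP, hPker, hPcover⟩ := Submodule.exists_fg_le_sup (LinearMap.ker g) B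
  have : FiniteDimensional k ↥(G ⊓ LinearMap.range g) :=
    Module.Finite.of_injective
      ((Submodule.inclusion (inf_le_left : G ⊓ LinearMap.range g ≤ G)).restrictScalars k)
      (Submodule.inclusion_injective inf_le_left)
  have : Module.Finite A ↥(G ⊓ LinearMap.range g) := Module.Finite.of_restrictScalars_finite k A _
  obtain ⟨Q, hQ, hQmap⟩ := Submodule.FG.exists_fg_map_eq g
    (Module.Finite.iff_fg.mp this) inf_le_right
  refine ⟨P ⊔ Q, hM _ (hP.sup hQ), ?_, hPcover.trans (sup_le_sup_right le_sup_left _)⟩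
  rw [Submodule.map_sup, hQmap, LinearMap.le_ker_iff_map.mp hPker, bot_sup_eq]

/-- The map on cohomology at position `i + 1` is bijective as soon as every boundary in `F (i + 1)`
bounds in `F i` and `F (i + 1)` covers the cycles modulo boundaries. -/
theorem inducedCohMap_bijective {A : Type*} [Ring A]
    {M : ℤ → Type*} [∀ i, AddCommGroup (M i)] [∀ i, Module A (M i)]
    (δ : ∀ i : ℤ, M i →ₗ[A] M (i + 1)) (hδδ : ∀ (i : ℤ) (x : M i), δ (i + 1) (δ i x) = 0)
    (F : ∀ i : ℤ, Submodule A (M i)) (i : ℤ)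
    (hinj : F (i + 1) ⊓ LinearMap.range (δ i) ≤ (F i).map (δ i))
    (hsurj : LinearMap.ker (δ (i + 1)) ≤ F (i + 1) ⊔ LinearMap.range (δ i)) :
    Function.Bijective (inducedCohMap δ F i) := by
  constructor
  · rw [injective_iff_map_eq_zero]
    intro a ha
    obtain ⟨x, rfl⟩ := Submodule.mkQ_surjective _ a
    have hx : (Submodule.comap (LinearMap.ker (δ (i + 1))).subtype (LinearMap.range (δ i))).mkQ
        (Submodule.inclusion inf_le_right x) = 0 := ha
    rw [Submodule.mkQ_apply, Submodule.Quotient.mk_eq_zero] at hx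
    exact (Submodule.Quotient.mk_eq_zero _).mpr (hinj ⟨x.2.1, hx⟩)
  · intro b
    obtain ⟨⟨x, hx⟩, rfl⟩ := Submodule.mkQ_surjective _ b
    obtain ⟨y, hy, _, ⟨w, rfl⟩, rfl⟩ := Submodule.mem_sup.mp (hsurj hx)
    have hyker : y ∈ LinearMap.ker (δ (i + 1)) := by
      simpa [hδδ] using hx
    refine ⟨Submodule.mkQ _ ⟨y, hy, hyker⟩, (Submodule.Quotient.eq _).mpr ?_⟩
    refine ⟨-w, ?_⟩
    simp

/-- Let `M` be a bounded complex of `A`-modules (over a `k`-algebra `A`) whose terms are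
locally finite `A`-modules and whose cohomology modules are finite-dimensional over `k`.
Then `M` admits a subcomplex `F` with all terms finite-dimensional over `k` such that the
inclusion `F ⊆ M` is a quasi-isomorphism. -/
theorem exists_finiteDimensional_quasiIso_subcomplex
    {k A : Type*} [Field k] [Ring A] [Algebra k A]
    (M : ℤ → Type*) [∀ i, AddCommGroup (M i)] [∀ i, Module k (M i)]
    [∀ i, Module A (M i)] [∀ i, IsScalarTower k A (M i)]
    (δ : ∀ i : ℤ, M i →ₗ[A] M (i + 1))
    (hδδ : ∀ (i : ℤ) (x : M i), δ (i + 1) (δ i x) = 0)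
    (hbdd : ∃ N : ℕ, ∀ i : ℤ, (N : ℤ) < |i| → ∀ x : M i, x = 0)
    (hlocfin : ∀ (i : ℤ) (p : Submodule A (M i)), p.FG → FiniteDimensional k ↥p)
    (hcohfin : ∀ i : ℤ, FiniteDimensional k
      (↥(LinearMap.ker (δ (i + 1))) ⧸
        Submodule.comap (LinearMap.ker (δ (i + 1))).subtype (LinearMap.range (δ i)))) :
    ∃ F : ∀ i : ℤ, Submodule A (M i),
      (∀ i : ℤ, ∀ x ∈ F i, δ i x ∈ F (i + 1)) ∧
      (∀ i : ℤ, FiniteDimensional k ↥(F i)) ∧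
      (∀ i : ℤ, Function.Bijective (inducedCohMap δ F i)) := by
  obtain ⟨N, hN⟩ := hbdd
  have key : ∀ n : ℕ, ∃ F : ∀ i : ℤ, Submodule A (M i), (∀ i, FiniteDimensional k (F i)) ∧
      ∀ j : ℤ, (N : ℤ) - n ≤ j →
        (F (j + 1)).map (δ (j + 1)) = F (j + 1 + 1) ⊓ LinearMap.range (δ (j + 1)) ∧
        LinearMap.ker (δ (j + 1)) ≤ F (j + 1) ⊔ LinearMap.range (δ j) := by
    intro n
    induction n with
    | zero =>
      refine ⟨fun _ => ⊥, fun i => hlocfin i ⊥ Submodule.fg_bot, fun j hj => ?_⟩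
      refine ⟨by simp, fun x _ => ?_⟩
      rw [hN (j + 1) (by rw [lt_abs]; left; push_cast at hj; lia) x]
      exact zero_mem _
    | succ n ih =>
      obtain ⟨F, hfin, hF⟩ := ih
      set m : ℤ := N - (n + 1 : ℕ) with hm
      obtain ⟨F₀, hfin₀, hmap, hker⟩ := exists_finiteDimensional_map_eq_inf_range (hlocfin (m + 1))
        (δ (m + 1)) (LinearMap.range (δ m)) (hcohfin m) (F (m + 1 + 1)) (hfin _)
      refine ⟨Function.update F (m + 1) F₀, fun i => ?_, fun j hj => ?_⟩
      · by_cases hi : i = m + 1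
        · subst hi
          rwa [Function.update_self]
        · rw [Function.update_of_ne hi]
          exact hfin i
      · rw [Function.update_of_ne (by lia : j + 1 + 1 ≠ m + 1)]
        rcases hj.eq_or_lt with rfl | hlt
        · simpa using ⟨hmap, hker⟩
        · rw [Function.update_of_ne (by lia : j + 1 ≠ m + 1)]
          exact hF j (by push_cast at hm; lia)
  obtain ⟨F, hfin, hF⟩ := key (2 * N + 2)
  have hmap : ∀ i, (F i).map (δ i) = F (i + 1) ⊓ LinearMap.range (δ i) := by
    intro i
    obtain ⟨j, rfl⟩ : ∃ j, i = j + 1 := ⟨i - 1, by ring⟩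
    rcases le_or_gt ((N : ℤ) - (2 * N + 2 : ℕ)) j with hj | hj
    · exact (hF j hj).1
    · have hzero := hN (j + 1) (by rw [lt_abs]; right; push_cast at hj; lia)
      have hδ : δ (j + 1) = 0 := LinearMap.ext fun x => by simp [hzero x]
      simp [hδ]
  have hker : ∀ i, LinearMap.ker (δ (i + 1)) ≤ F (i + 1) ⊔ LinearMap.range (δ i) := by
    intro i
    rcases le_or_gt ((N : ℤ) - (2 * N + 2 : ℕ)) i with hi | hi
    · exact (hF i hi).2
    · intro x _
      rw [hN (i + 1) (by rw [lt_abs]; right; push_cast at hi; lia) x]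
      exact zero_mem _
  refine ⟨F, fun i x hx => ?_, hfin, fun i =>
    inducedCohMap_bijective δ hδδ F i (hmap i).ge (hker i)⟩
  exact ((hmap i).le (Submodule.mem_map_of_mem hx)).1
end
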